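/- Let S ⊆ ℝ² be a nonempty set with diameter d(S) ≤ d, let x* ∈ S, let 0 ≤ R̲ ≤ R̄ with d < R̲, set R̲̃ = R̲ − d and R̃̄ = R̄ + d, let Z̄ ⊆ ℝ², and let α ≤ β with β − α < π. Assume that every point z ∈ (S ⊕ Y(R̲,R̄)) ∩ Z̄ can be written as z = x* + ρ·u(θ) with ρ > 0 and θ ∈ [α, β]. Then (S ⊕ Y(R̲,R̄)) ∩ Z̄ is contained in the set { x* + ξ₁·u(β) + ξ₂·u(α) : 0 ≤ ξ₁ ≤ R̃̄/cos((β−α)/2), 0 ≤ ξ₂ ≤ R̃̄/cos((β−α)/2), and R̲̃·cos((β−α)/2) ≤ ⟨u((α+β)/2), ξ₁·u(β) + ξ₂·u(α)⟩ ≤ R̃̄ }. (Theorem 1 of the paper: the intersection of the Minkowski sum of the neighbor's posterior set with the measurement ring and the prior set is outer bounded by an extended constrained zonotope centered at any point x* of the neighbor's posterior set, built from the enlarged ring radii R̲ − d and R̄ + d and the angular span of the intersecting sectors.) -/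

import Mathlib

open scoped Pointwise RealInnerProductSpace

/-- The unit vector `u(θ) = (cos θ, sin θ) ∈ ℝ²`. -/
noncomputable def u (θ : ℝ) : EuclideanSpace ℝ (Fin 2) :=
  (WithLp.equiv 2 (Fin 2 → ℝ)).symm ![Real.cos θ, Real.sin θ]

theorem u_apply_zero (θ : ℝ) : u θ 0 = Real.cos θ := rfl

theorem u_apply_one (θ : ℝ) : u θ 1 = Real.sin θ := rfl

theorem inner_u_u (s t : ℝ) : ⟪u s, u t⟫ = Real.cos (t - s) := by
  rw [PiLp.inner_apply, Fin.sum_univ_two, u_apply_zero, u_apply_zero, u_apply_one, u_apply_one,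
    Real.cos_sub]
  simp

theorem norm_u (θ : ℝ) : ‖u θ‖ = 1 := by
  rw [norm_eq_sqrt_real_inner, inner_u_u]
  simp

theorem sin_div_smul_u_add_sin_div_smul_u {a b : ℝ} (t : ℝ) (h : Real.sin (b - a) ≠ 0) :
    (Real.sin (t - a) / Real.sin (b - a)) • u b + (Real.sin (b - t) / Real.sin (b - a)) • u a
      = u t := by
  ext i
  fin_cases i
  · change Real.sin (t - a) / Real.sin (b - a) * Real.cos b
      + Real.sin (b - t) / Real.sin (b - a) * Real.cos a = Real.cos t
    field_simp
    simp only [Real.sin_sub]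
    ring
  · change Real.sin (t - a) / Real.sin (b - a) * Real.sin b
      + Real.sin (b - t) / Real.sin (b - a) * Real.sin a = Real.sin t
    field_simp
    simp only [Real.sin_sub]
    ring

theorem sin_div_sin_le_one_div_cos_half {t w : ℝ} (ht : 0 ≤ t) (htw : t ≤ w) (hw : 0 < w)
    (hwπ : w < Real.pi) : Real.sin t / Real.sin w ≤ 1 / Real.cos (w / 2) := by
  have hc : 0 < Real.cos (w / 2) := Real.cos_pos_of_mem_Ioo ⟨by linarith, by linarith⟩
  have hs : 0 < Real.sin (w / 2) := Real.sin_pos_of_pos_of_lt_pi (by linarith) (by linarith)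
  have hst : 0 ≤ Real.sin (t / 2) :=
    Real.sin_nonneg_of_nonneg_of_le_pi (by linarith) (by linarith)
  have hle : Real.sin (t / 2) ≤ Real.sin (w / 2) :=
    Real.sin_le_sin_of_le_of_le_pi_div_two (by linarith) (by linarith) (by linarith)
  have h2t : Real.sin t = 2 * Real.sin (t / 2) * Real.cos (t / 2) := by
    rw [← Real.sin_two_mul]
    ring_nf
  have h2w : Real.sin w = 2 * Real.sin (w / 2) * Real.cos (w / 2) := by
    rw [← Real.sin_two_mul]
    ring_nf
  rw [div_le_div_iff₀ (by rw [h2w]; positivity) hc, h2t, h2w]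
  have := mul_le_of_le_one_right hst (Real.cos_le_one (t / 2))
  nlinarith

/-- A unit vector in the sector spanned by `u α` and `u β` is a nonnegative combination of these,
with coefficients at most `1 / cos ((β - α) / 2)`. -/
theorem exists_u_eq_smul_add_smul {α β θ : ℝ} (hπ : β - α < Real.pi) (hθ : θ ∈ Set.Icc α β) :
    ∃ c₁ c₂ : ℝ, 0 ≤ c₁ ∧ c₁ ≤ 1 / Real.cos ((β - α) / 2) ∧
      0 ≤ c₂ ∧ c₂ ≤ 1 / Real.cos ((β - α) / 2) ∧ u θ = c₁ • u β + c₂ • u α := by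
  obtain ⟨hα, hβ⟩ := hθ
  rcases (hα.trans hβ).eq_or_lt with rfl | hlt
  · obtain rfl : θ = α := le_antisymm hβ hα
    exact ⟨1, 0, by simp⟩
  · have hs : 0 < Real.sin (β - α) := Real.sin_pos_of_pos_of_lt_pi (by linarith) hπ
    exact ⟨Real.sin (θ - α) / Real.sin (β - α), Real.sin (β - θ) / Real.sin (β - α),
      div_nonneg (Real.sin_nonneg_of_nonneg_of_le_pi (by linarith) (by linarith)) hs.le,
      sin_div_sin_le_one_div_cos_half (by linarith) (by linarith) (by linarith) hπ,
      div_nonneg (Real.sin_nonneg_of_nonneg_of_le_pi (by linarith) (by linarith)) hs.le,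
      sin_div_sin_le_one_div_cos_half (by linarith) (by linarith) (by linarith) hπ,
      (sin_div_smul_u_add_sin_div_smul_u θ hs.ne').symm⟩

/-- Theorem 1 of the paper: the intersection of the Minkowski sum of the neighbor's
posterior set `S` with the measurement ring `Y(R̲, R̄)` and the prior set `Z̄` is outer
bounded by an extended constrained zonotope centered at any fixed `x* ∈ S`, built from the
enlarged ring radii `R̲ − d`, `R̄ + d` and the angular span `[α, β]` of the intersecting
sectors. -/
theorem stmt14 (S : Set (EuclideanSpace ℝ (Fin 2))) (hS : S.Nonempty) (d : ℝ)
    (hd : ∀ s₁ ∈ S, ∀ s₂ ∈ S, ‖s₁ - s₂‖ ≤ d)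
    (xstar : EuclideanSpace ℝ (Fin 2)) (hx : xstar ∈ S)
    (Rlo Rhi : ℝ) (h0 : 0 ≤ Rlo) (hR : Rlo ≤ Rhi) (hdR : d < Rlo)
    (Zbar : Set (EuclideanSpace ℝ (Fin 2))) (α β : ℝ) (hαβ : α ≤ β) (hπ : β - α < Real.pi)
    (hsector : ∀ z ∈ (S + {s : EuclideanSpace ℝ (Fin 2) | Rlo ≤ ‖s‖ ∧ ‖s‖ ≤ Rhi}) ∩ Zbar,
      ∃ ρ : ℝ, 0 < ρ ∧ ∃ θ ∈ Set.Icc α β, z = xstar + ρ • u θ) :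
    (S + {s : EuclideanSpace ℝ (Fin 2) | Rlo ≤ ‖s‖ ∧ ‖s‖ ≤ Rhi}) ∩ Zbar ⊆
      {z : EuclideanSpace ℝ (Fin 2) |
        ∃ ξ₁ ξ₂ : ℝ,
          0 ≤ ξ₁ ∧ ξ₁ ≤ (Rhi + d) / Real.cos ((β - α) / 2) ∧
          0 ≤ ξ₂ ∧ ξ₂ ≤ (Rhi + d) / Real.cos ((β - α) / 2) ∧
          (Rlo - d) * Real.cos ((β - α) / 2) ≤
            ⟪u ((α + β) / 2), ξ₁ • u β + ξ₂ • u α⟫ ∧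
          ⟪u ((α + β) / 2), ξ₁ • u β + ξ₂ • u α⟫ ≤ Rhi + d ∧
          z = xstar + (ξ₁ • u β + ξ₂ • u α)} := by
  intro z hz
  obtain ⟨ρ, hρ, θ, hθ, hzθ⟩ := hsector z hz
  obtain ⟨⟨s, hs, y, ⟨hylo, hyhi⟩, hsy⟩, -⟩ := hz
  have hsx : ‖s - xstar‖ ≤ d := hd s hs xstar hx
  have hnorm : ‖(s - xstar) + y‖ = ρ := by
    have : (s - xstar) + y = ρ • u θ := by
      have hsum : s + y = xstar + ρ • u θ := hsy.trans hzθ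
      rw [sub_add_eq_add_sub, hsum, add_sub_cancel_left]
    rw [this, norm_smul, norm_u, Real.norm_of_nonneg hρ.le, mul_one]
  have hρhi : ρ ≤ Rhi + d := by
    have := norm_add_le (s - xstar) y
    linarith
  have hρlo : Rlo - d ≤ ρ := by
    have := norm_sub_le ((s - xstar) + y) (s - xstar)
    rw [add_sub_cancel_left] at this
    linarith
  obtain ⟨c₁, c₂, hc₁, hc₁', hc₂, hc₂', hu⟩ := exists_u_eq_smul_add_smul hπ hθ
  obtain ⟨hα, hβ⟩ := hθ
  have hcos : 0 < Real.cos ((β - α) / 2) :=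
    Real.cos_pos_of_mem_Ioo ⟨by linarith, by linarith⟩
  have hcosle : Real.cos ((β - α) / 2) ≤ Real.cos (θ - (α + β) / 2) := by
    rw [← Real.cos_abs (θ - (α + β) / 2)]
    exact Real.cos_le_cos_of_nonneg_of_le_pi (abs_nonneg _) (by linarith)
      (abs_le.2 ⟨by linarith, by linarith⟩)
  have hcomb : (ρ * c₁) • u β + (ρ * c₂) • u α = ρ • u θ := by
    rw [hu, smul_add, smul_smul, smul_smul]
  have hbound : ∀ c : ℝ, c ≤ 1 / Real.cos ((β - α) / 2) →
      ρ * c ≤ (Rhi + d) / Real.cos ((β - α) / 2) := fun c hc ↦ by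
    calc ρ * c ≤ ρ * (1 / Real.cos ((β - α) / 2)) := by gcongr
      _ = ρ / Real.cos ((β - α) / 2) := by ring
      _ ≤ (Rhi + d) / Real.cos ((β - α) / 2) := by gcongr
  refine ⟨ρ * c₁, ρ * c₂, by positivity, hbound c₁ hc₁', by positivity, hbound c₂ hc₂', ?_⟩
  rw [hcomb, real_inner_smul_right, inner_u_u]
  refine ⟨?_, ?_, hzθ⟩
  · exact mul_le_mul hρlo hcosle hcos.le hρ.le
  · exact (mul_le_of_le_one_right hρ.le (Real.cos_le_one _)).trans hρhi
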